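/- Let h=3 and let n≥0 be an integer. For 0≤i≤n define θ̃_{n−i,i}∈V_{3,n} by θ̃_{n−i,i}(x_1,x_2) = Q_{n−i}(x_1+x_2−i; α_1α_2 q^{2i+1}, α_3, n−i | q)·Q_i(x_1; α_1, α_2, x_1+x_2 | q) when x_1+x_2≥i, and 0 otherwise. Suppose f∈V_{3,n} satisfies L_n f=0 and f = ∑_{i=0}^{n} a_i θ̃_{n−i,i} with a_0,…,a_n∈ℂ. Then for every 0≤i≤n: a_i = ((−α_2)^i (α_1 q;q)_i q^{(3i²+i+n²)/2−ni})/((q;q)_{n−i}(α_1α_2 q^{i+1};q)_i (α_2 q;q)_i (q;q)_i) · ∑_{k=0}^{i} (−1)^k (α_1α_2)^{−k} q^{−k(k+1)/2} · ((α_3 q^{n−i+1};q)_{i−k}(q^{−i};q)_k(α_1α_2 q^{i+1};q)_k/(q;q)_k) · f(k,0), where q^{(3i²+i+n²)/2−ni} denotes the real power of q. -/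

import Mathlib

open Finset

noncomputable section

/-- q-shifted factorial `(a;q)_m`. -/
def qPoch (q a : ℝ) (m : ℕ) : ℝ := ∏ k ∈ Finset.range m, (1 - a * q ^ k)

/-- Two-variable raising operator `R_M : V_{2,M} → V_{2,M+1}` (on functions of `x = x₁`). -/
def R2 (q : ℝ) (M : ℕ) (g : ℕ → ℂ) : ℕ → ℂ := fun x =>
  (q : ℂ) ^ (-(M : ℤ) - 1) * (1 - (q : ℂ) ^ x) * g (x - 1) +
    (q : ℂ) ^ ((x : ℤ) - M - 1) * (1 - (q : ℂ) ^ ((M : ℤ) + 1 - x)) * g x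

/-- `R2Iter q n k g = R_{n+k-1} ⋯ R_{n+1} R_n g`. -/
def R2Iter (q : ℝ) (n : ℕ) : ℕ → (ℕ → ℂ) → (ℕ → ℂ)
  | 0, g => g
  | k + 1, g => R2 q (n + k) (R2Iter q n k g)

/-- The function `φ_n(x) = q^{-n²/2}(q;q)_n (abq^{n+1})^x (b⁻¹q^{-n};q)_x / (aq;q)_x`. -/
def phiH (q a b : ℝ) (n : ℕ) : ℕ → ℂ := fun x =>
  ((q ^ (-((n : ℝ) ^ 2) / 2) * qPoch q q n * (a * b * q ^ (n + 1)) ^ x *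
      qPoch q (b⁻¹ * q ^ (-(n : ℤ))) x / qPoch q (a * q) x : ℝ) : ℂ)

/-- The one-dimensional q-Hahn polynomial `Q_n(x; a, b, N | q)`. -/
def qHahnQ (q a b : ℝ) (n N : ℕ) : ℕ → ℂ := fun x =>
  ((q : ℂ) ^ ((N - n) * (N - n + 1) / 2) / ((qPoch q q (N - n) : ℝ) : ℂ)) *
    R2Iter q n (N - n) (phiH q a b n) x

/-- The lowering operator `L_N : V_{3,N} → V_{3,N-1}` in the coordinates `(x₁, x₂)`. -/
def L3 (q a₁ a₂ a₃ : ℝ) (N : ℕ) (f : ℕ → ℕ → ℂ) : ℕ → ℕ → ℂ := fun x₁ x₂ =>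
  ((a₁ : ℂ) * (q : ℂ) ^ (x₁ + 1) - 1) * f (x₁ + 1) x₂ +
    (a₁ : ℂ) * (q : ℂ) ^ (x₁ + 1) * ((a₂ : ℂ) * (q : ℂ) ^ (x₂ + 1) - 1) * f x₁ (x₂ + 1) +
    (a₁ : ℂ) * (a₂ : ℂ) * (q : ℂ) ^ (x₁ + x₂ + 2) *
      ((a₃ : ℂ) * (q : ℂ) ^ ((N : ℤ) - x₁ - x₂) - 1) * f x₁ x₂

theorem qPoch_zero (q a : ℝ) : qPoch q a 0 = 1 := by simp [qPoch]

theorem qPoch_succ (q a : ℝ) (m : ℕ) : qPoch q a (m + 1) = qPoch q a m * (1 - a * q ^ m) := by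
  simp [qPoch, Finset.prod_range_succ]

theorem qPoch_add (q a : ℝ) (m k : ℕ) :
    qPoch q a (m + k) = qPoch q a m * qPoch q (a * q ^ m) k := by
  simp only [qPoch, Finset.prod_range_add, pow_add, mul_assoc]

theorem qPoch_succ' (q a : ℝ) (m : ℕ) :
    qPoch q a (m + 1) = (1 - a) * qPoch q (a * q) m := by
  rw [add_comm, qPoch_add, qPoch_succ, qPoch_zero]
  simp

theorem qPoch_pos {q a : ℝ} (hq0 : 0 < q) (hq1 : q < 1) (ha0 : 0 ≤ a) (ha : a < 1) (m : ℕ) :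
    0 < qPoch q a m :=
  Finset.prod_pos fun _ _ => sub_pos.2
    ((mul_le_of_le_one_right ha0 (pow_le_one₀ hq0.le hq1.le)).trans_lt ha)

/-- Reversal of a q-shifted factorial with inverted base point. -/
theorem qPoch_inv_mul (q : ℝ) (hq : q ≠ 0) (b : ℝ) (hb : b ≠ 0) (x : ℕ) : ∀ r : ℕ,
    (b * q ^ (x + r)) ^ x * qPoch q (b⁻¹ * q ^ (-((x + r : ℕ) : ℤ))) x =
      (-1) ^ x * q ^ x.choose 2 * qPoch q (b * q ^ (r + 1)) x := by
  induction x with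
  | zero => simp [qPoch_zero]
  | succ x ih =>
    intro r
    have h := ih (r + 1)
    rw [show x + (r + 1) = x + 1 + r by ring] at h
    rw [qPoch_succ, qPoch_succ' q (b * q ^ (r + 1)), pow_succ,
      show (b * q ^ (r + 1) * q) = b * q ^ (r + 1 + 1) by ring,
      Nat.choose_succ_succ' x 1, Nat.choose_one_right]
    have key : b * q ^ (x + 1 + r) * (1 - b⁻¹ * q ^ (-((x + 1 + r : ℕ) : ℤ)) * q ^ x) =
        -q ^ x * (1 - b * q ^ (r + 1)) := by
      rw [zpow_neg, zpow_natCast]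
      field_simp
      ring
    calc _ = (b * q ^ (x + 1 + r)) ^ x * qPoch q (b⁻¹ * q ^ (-((x + 1 + r : ℕ) : ℤ))) x *
          (b * q ^ (x + 1 + r) * (1 - b⁻¹ * q ^ (-((x + 1 + r : ℕ) : ℤ)) * q ^ x)) := by ring
      _ = _ := by
        rw [h, key]
        ring

theorem qPoch_neg_self (q : ℝ) (hq : q ≠ 0) (i : ℕ) :
    q ^ (i * i) * qPoch q (q ^ (-(i : ℤ))) i = (-1) ^ i * q ^ i.choose 2 * qPoch q q i := by
  have h := qPoch_inv_mul q hq 1 one_ne_zero i 0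
  simpa [← pow_mul] using h

/-- Indefinite summation of the terms of `₂φ₁(a, b; abq; q, q)`. -/
theorem sum_qPoch_telescope (q a b : ℝ) (L : ℕ) (h1 : ∀ l, qPoch q q l ≠ 0)
    (h2 : ∀ l, qPoch q (a * b * q) l ≠ 0) :
    ∑ l ∈ Finset.range (L + 1), q ^ l * (qPoch q a l * qPoch q b l) /
        (qPoch q q l * qPoch q (a * b * q) l) =
      qPoch q (a * q) L * qPoch q (b * q) L / (qPoch q q L * qPoch q (a * b * q) L) := by
  induction L with
  | zero => simp [qPoch_zero]
  | succ L ih =>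
    rw [Finset.sum_range_succ, ih, qPoch_succ' q a, qPoch_succ' q b]
    have e1 := h1 (L + 1)
    have e2 := h2 (L + 1)
    rw [qPoch_succ] at e1 e2
    rw [qPoch_succ, qPoch_succ q (a * b * q), qPoch_succ q (a * q), qPoch_succ q (b * q)]
    rw [div_add_div _ _ (mul_ne_zero (h1 L) (h2 L)) (mul_ne_zero e1 e2),
      div_eq_div_iff (mul_ne_zero (mul_ne_zero (h1 L) (h2 L)) (mul_ne_zero e1 e2))
        (mul_ne_zero e1 e2)]
    ring

theorem sum_qPoch_eq_zero (q b c : ℝ) (hq : q ≠ 0) (m : ℕ) (hm : m ≠ 0) (hc : c * q ^ m = b * q)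
    (h1 : ∀ l, qPoch q q l ≠ 0) (h2 : ∀ l, qPoch q c l ≠ 0) :
    ∑ l ∈ Finset.range (m + 1), q ^ l * (qPoch q (q ^ (-(m : ℤ))) l * qPoch q b l) /
        (qPoch q q l * qPoch q c l) = 0 := by
  have e : q ^ (-(m : ℤ)) * b * q = c := by
    rw [zpow_neg, zpow_natCast]
    field_simp
    linear_combination -hc
  have h := sum_qPoch_telescope q (q ^ (-(m : ℤ))) b m h1 (by rwa [e])
  rw [e] at h
  rw [h]
  obtain ⟨m, rfl⟩ := Nat.exists_eq_succ_of_ne_zero hm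
  have : q ^ (-((m.succ : ℕ) : ℤ)) * q * q ^ m = 1 := by
    rw [zpow_neg, zpow_natCast, Nat.succ_eq_add_one]
    field_simp
    ring
  rw [Nat.succ_eq_add_one, qPoch_succ q (_ * q), ← Nat.succ_eq_add_one, this]
  simp

theorem R2Iter_top (q : ℝ) (hq : q ≠ 0) (n k : ℕ) (g : ℕ → ℂ) :
    R2Iter q n k g (n + k) * ((q ^ (n * k + (k + 1).choose 2) * qPoch q q n : ℝ) : ℂ) =
      ((qPoch q q (n + k) : ℝ) : ℂ) * g n := by
  have hq' : (q : ℂ) ≠ 0 := by exact_mod_cast hq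
  induction k with
  | zero => simp [R2Iter, mul_comm]
  | succ k ih =>
    rw [R2Iter, R2]
    have e0 : ((n + k : ℕ) : ℤ) + 1 - ((n + (k + 1) : ℕ) : ℤ) = 0 := by push_cast; ring
    have e1 : -((n + k : ℕ) : ℤ) - 1 = -((n + k + 1 : ℕ) : ℤ) := by push_cast; ring
    rw [e0, e1, show n + (k + 1) - 1 = n + k by omega, zpow_zero, sub_self, mul_zero, zero_mul,
      add_zero, zpow_neg, zpow_natCast, ← add_assoc, qPoch_succ, Nat.choose_succ_succ' (k + 1) 1,
      Nat.choose_one_right, show n * (k + 1) + (k + 1 + (k + 1).choose 2) =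
        (n + k + 1) + (n * k + (k + 1).choose 2) by ring, pow_add q (n + k + 1)]
    push_cast at ih ⊢
    calc _ = (1 - (q : ℂ) ^ (n + k + 1)) * (R2Iter q n k g (n + k) *
            ((q : ℂ) ^ (n * k + (k + 1).choose 2) * (qPoch q q n : ℂ))) := by
          field_simp
      _ = _ := by
          rw [ih]
          ring

theorem qHahnQ_top (q : ℝ) (hq : q ≠ 0) (a b : ℝ) (n k : ℕ) (h : ∀ l, qPoch q q l ≠ 0) :
    qHahnQ q a b n (n + k) (n + k) =
      ((qPoch q q (n + k) / (q ^ (n * k) * qPoch q q k * qPoch q q n) : ℝ) : ℂ) *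
        phiH q a b n n := by
  have hq' : (q : ℂ) ≠ 0 := by exact_mod_cast hq
  have hn : ((qPoch q q n : ℝ) : ℂ) ≠ 0 := by exact_mod_cast h n
  have hk : ((qPoch q q k : ℝ) : ℂ) ≠ 0 := by exact_mod_cast h k
  have ht := R2Iter_top q hq n k (phiH q a b n)
  rw [qHahnQ, Nat.add_sub_cancel_left,
    show k * (k + 1) / 2 = (k + 1).choose 2 by
      rw [Nat.choose_two_right, Nat.add_sub_cancel, mul_comm]]
  push_cast at ht ⊢
  rw [pow_add] at ht
  rw [div_mul_eq_mul_div, div_mul_eq_mul_div, ← ht]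
  field_simp

theorem qHahnQ_self (q a b : ℝ) (n : ℕ) : qHahnQ q a b n n = phiH q a b n := by
  funext x
  simp [qHahnQ, R2Iter, qPoch_zero]

theorem phiH_eq (q : ℝ) (hq : q ≠ 0) (a b : ℝ) (hb : b ≠ 0) (x r : ℕ) :
    phiH q a b (x + r) x =
      ((q ^ (-(((x + r : ℕ) : ℝ) ^ 2) / 2) * qPoch q q (x + r) * (-(a * q)) ^ x * q ^ x.choose 2 *
        qPoch q (b * q ^ (r + 1)) x / qPoch q (a * q) x : ℝ) : ℂ) := by
  rw [phiH]
  congr 2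
  have h := qPoch_inv_mul q hq b hb x r
  rw [show (a * b * q ^ (x + r + 1)) ^ x = (a * q) ^ x * (b * q ^ (x + r)) ^ x by
    rw [← mul_pow]; ring, show (-(a * q)) ^ x = (-1) ^ x * (a * q) ^ x by rw [neg_pow]]
  linear_combination q ^ (-(((x + r : ℕ) : ℝ) ^ 2) / 2) * qPoch q q (x + r) * (a * q) ^ x * h

/-- The weight of `f k 0` in the inversion formula, where `s = n - i`. -/
def invWeight (q t c : ℝ) (s i k : ℕ) : ℝ :=
  (-1 : ℝ) ^ k * t ^ (-(k : ℤ)) * q ^ (-((k * (k + 1) / 2 : ℕ) : ℤ)) *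
    (qPoch q (c * q ^ (s + 1)) (i - k) * qPoch q (q ^ (-(i : ℤ))) k *
      qPoch q (t * q ^ (i + 1)) k / qPoch q q k)

/-- The `x`-dependent factor of the `j`-th basis function at `(j + l, 0)`, where
`r = n - j - l`. -/
def edgeFactor (q t c : ℝ) (r j l : ℕ) : ℝ :=
  (-(t * q ^ (j + 2))) ^ l * q ^ l.choose 2 * qPoch q (c * q ^ (r + 1)) l * qPoch q q (j + l) /
    (qPoch q (t * q ^ (2 * j + 2)) l * qPoch q q l)

/-- The `x`-independent factor of the `j`-th basis function on the edge `x₂ = 0`. -/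
def edgeConst (q a₁ a₂ : ℝ) (n j : ℕ) : ℝ :=
  q ^ (-(((n - j : ℕ) : ℝ) ^ 2) / 2) * qPoch q q (n - j) *
    (q ^ (-((j : ℝ) ^ 2) / 2) * (-(a₁ * q)) ^ j * q ^ j.choose 2 *
      qPoch q (a₂ * q) j / qPoch q (a₁ * q) j)

theorem edge_value (q : ℝ) (hq : q ≠ 0) (a₁ a₂ a₃ : ℝ) (h₂ : a₂ ≠ 0) (h₃ : a₃ ≠ 0)
    (h : ∀ l, qPoch q q l ≠ 0) (j l r : ℕ) :
    qHahnQ q (a₁ * a₂ * q ^ (2 * j + 1)) a₃ (l + r) (l + r) l * qHahnQ q a₁ a₂ j (j + l) (j + l) =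
      ((edgeConst q a₁ a₂ (j + l + r) j * edgeFactor q (a₁ * a₂) a₃ r j l : ℝ) : ℂ) := by
  have hphi := phiH_eq q hq a₁ a₂ h₂ j 0
  rw [zero_add, pow_one, add_zero] at hphi
  rw [qHahnQ_self, qHahnQ_top q hq _ _ _ _ h, phiH_eq q hq _ _ h₃, hphi, ← Complex.ofReal_mul,
    ← Complex.ofReal_mul]
  congr 1
  rw [edgeConst, edgeFactor, show j + l + r - j = l + r by omega,
    show a₁ * a₂ * q ^ (2 * j + 1) * q = a₁ * a₂ * q ^ (2 * j + 2) by ring]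
  have hp : (-(a₁ * a₂ * q ^ (2 * j + 2))) ^ l = (-(a₁ * a₂ * q ^ (j + 2))) ^ l * q ^ (j * l) := by
    rw [pow_mul, ← mul_pow]
    ring
  rw [hp]
  generalize q ^ (-(((l + r : ℕ) : ℝ) ^ 2) / 2) = y'
  generalize q ^ (-((j : ℝ) ^ 2) / 2) = z'
  simp only [div_eq_mul_inv, mul_inv]
  generalize (qPoch q (a₁ * a₂ * q ^ (2 * j + 2)) l)⁻¹ = u
  generalize (qPoch q (a₁ * q) j)⁻¹ = v
  generalize (qPoch q q l)⁻¹ = w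
  generalize (-(a₁ * a₂ * q ^ (j + 2))) ^ l = y
  generalize (-(a₁ * q)) ^ j = z
  have e : q ^ (j * l) * (q ^ (j * l))⁻¹ = 1 := mul_inv_cancel₀ (pow_ne_zero _ hq)
  have e' : qPoch q q j * (qPoch q q j)⁻¹ = 1 := mul_inv_cancel₀ (h j)
  generalize (q ^ (j * l))⁻¹ = p at *
  generalize (qPoch q q j)⁻¹ = p' at *
  generalize q ^ (j * l) = o at *
  generalize qPoch q q j = o' at *
  linear_combination y' * qPoch q q (l + r) * y * q ^ l.choose 2 *
    qPoch q (a₃ * q ^ (r + 1)) l * u * qPoch q q (j + l) * w * z' * z * q ^ j.choose 2 *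
    qPoch q (a₂ * q) j * v * (e' * (o * p) + e)

theorem choose_two_add (j l : ℕ) :
    (j + l + 1).choose 2 = (j + 1).choose 2 + l.choose 2 + (j + 1) * l := by
  induction l with
  | zero => simp
  | succ l ih =>
    rw [← add_assoc, Nat.choose_succ_succ' (j + l + 1) 1, ih, Nat.choose_succ_succ' l 1]
    simp only [Nat.choose_one_right]
    ring

theorem invWeight_mul_edgeFactor (q : ℝ) (hq : q ≠ 0) (t c : ℝ) (ht : t ≠ 0)
    (h : ∀ l, qPoch q q l ≠ 0) (s j l p : ℕ) :
    invWeight q t c s (j + (l + p)) (j + l) * edgeFactor q t c (s + p) j l =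
      ((-1 : ℝ) ^ j * (t ^ j)⁻¹ * (q ^ (j + 1).choose 2)⁻¹ *
        qPoch q (q ^ (-((j + (l + p) : ℕ) : ℤ))) j * qPoch q (t * q ^ (j + (l + p) + 1)) j *
        qPoch q (c * q ^ (s + 1)) (l + p)) *
      (q ^ l * (qPoch q (q ^ (-((l + p : ℕ) : ℤ))) l * qPoch q (t * q ^ (j + (j + (l + p)) + 1)) l) /
        (qPoch q q l * qPoch q (t * q ^ (2 * j + 2)) l)) := by
  rw [invWeight, edgeFactor, show j + (l + p) - (j + l) = p by omega,
    show (j + l) * (j + l + 1) / 2 = (j + l + 1).choose 2 by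
      rw [Nat.choose_two_right, Nat.add_sub_cancel, mul_comm],
    qPoch_add q (q ^ (-((j + (l + p) : ℕ) : ℤ))), qPoch_add q (t * q ^ (j + (l + p) + 1)),
    add_comm l p, qPoch_add q (c * q ^ (s + 1)) p l]
  have e1 : q ^ (-((j + (p + l) : ℕ) : ℤ)) * q ^ j = q ^ (-((p + l : ℕ) : ℤ)) := by
    rw [← zpow_natCast q j, ← zpow_add₀ hq]
    congr 1
    push_cast
    ring
  have e2 : t * q ^ (j + (p + l) + 1) * q ^ j = t * q ^ (j + (j + (p + l)) + 1) := by ring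
  have e3 : c * q ^ (s + 1) * q ^ p = c * q ^ (s + p + 1) := by ring
  have e4 : (-1 : ℝ) ^ (j + l) * t ^ (-((j + l : ℕ) : ℤ)) * q ^ (-(((j + l + 1).choose 2 : ℕ) : ℤ)) *
      ((-(t * q ^ (j + 2))) ^ l * q ^ l.choose 2) =
      (-1 : ℝ) ^ j * (t ^ j)⁻¹ * (q ^ (j + 1).choose 2)⁻¹ * q ^ l := by
    have hs : ((-1 : ℝ) ^ l) * (-1) ^ l = 1 := by rw [← mul_pow]; simp
    rw [zpow_neg, zpow_natCast, zpow_neg, zpow_natCast, choose_two_add, neg_pow (t * _), mul_pow,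
      ← pow_mul, pow_add (-1 : ℝ), pow_add t, pow_add q, pow_add q,
      show (j + 2) * l = (j + 1) * l + l by ring, pow_add q _ l]
    field_simp
    linear_combination hs
  rw [e1, e2, e3]
  have e5 : qPoch q q (j + l) * (qPoch q q (j + l))⁻¹ = 1 := mul_inv_cancel₀ (h _)
  calc _ = ((-1 : ℝ) ^ (j + l) * t ^ (-((j + l : ℕ) : ℤ)) *
        q ^ (-(((j + l + 1).choose 2 : ℕ) : ℤ)) * ((-(t * q ^ (j + 2))) ^ l * q ^ l.choose 2)) *
      (qPoch q (c * q ^ (s + 1)) p * qPoch q (q ^ (-((j + (p + l) : ℕ) : ℤ))) j *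
        qPoch q (q ^ (-((p + l : ℕ) : ℤ))) l * qPoch q (t * q ^ (j + (p + l) + 1)) j *
        qPoch q (t * q ^ (j + (j + (p + l)) + 1)) l * qPoch q (c * q ^ (s + p + 1)) l /
        (qPoch q (t * q ^ (2 * j + 2)) l * qPoch q q l)) *
      (qPoch q q (j + l) * (qPoch q q (j + l))⁻¹) := by
        simp only [div_eq_mul_inv, mul_inv]
        ac_rfl
    _ = _ := by
        rw [e4, e5]
        ring

theorem invWeight_mul_edge_self (q : ℝ) (hq : 0 < q) (a₁ a₂ c : ℝ) (h₁ : a₁ ≠ 0) (h₂ : a₂ ≠ 0)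
    (h : ∀ l, qPoch q q l ≠ 0) (n i : ℕ) (hi : i ≤ n) (g1 : qPoch q (a₁ * q) i ≠ 0)
    (g2 : qPoch q (a₂ * q) i ≠ 0) (g3 : qPoch q (a₁ * a₂ * q ^ (i + 1)) i ≠ 0) :
    (-a₂) ^ i * qPoch q (a₁ * q) i *
          q ^ ((3 * (i : ℝ) ^ 2 + (i : ℝ) + (n : ℝ) ^ 2) / 2 - (n : ℝ) * (i : ℝ)) /
          (qPoch q q (n - i) * qPoch q (a₁ * a₂ * q ^ (i + 1)) i * qPoch q (a₂ * q) i *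
            qPoch q q i) *
      (invWeight q (a₁ * a₂) c (n - i) i i *
        (edgeConst q a₁ a₂ n i * edgeFactor q (a₁ * a₂) c (n - i) i 0)) = 1 := by
  have er : q ^ ((3 * (i : ℝ) ^ 2 + (i : ℝ) + (n : ℝ) ^ 2) / 2 - (n : ℝ) * (i : ℝ)) *
      q ^ (-(((n - i : ℕ) : ℝ) ^ 2) / 2) * q ^ (-((i : ℝ) ^ 2) / 2) = q ^ (i + i.choose 2) := by
    rw [← Real.rpow_add hq, ← Real.rpow_add hq, ← Real.rpow_natCast q]
    congr 1
    push_cast [Nat.cast_sub hi, Nat.cast_choose_two]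
    ring
  have hs : ((-1 : ℝ) ^ i) * (-1) ^ i = 1 := by rw [← mul_pow]; simp
  have hX : (-1) ^ i * q ^ (i + i.choose 2) * qPoch q (q ^ (-(i : ℤ))) i = qPoch q q i := by
    have hc : i * i = i + i.choose 2 + i.choose 2 := by
      have h2 := Nat.choose_succ_succ' i 1
      rw [Nat.choose_one_right] at h2
      have h3 : 2 * (i + 1).choose 2 = (i + 1) * i := by
        rw [Nat.choose_two_right, Nat.add_sub_cancel]
        exact Nat.mul_div_cancel' (Nat.even_mul_pred_self (i + 1)).two_dvd
      nlinarith
    have h0 := qPoch_neg_self q hq.ne' i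
    rw [hc, pow_add] at h0
    apply mul_left_cancel₀ (pow_ne_zero (i.choose 2) hq.ne')
    linear_combination (-1) ^ i * h0 + q ^ i.choose 2 * qPoch q q i * hs
  have hp : (-a₂) ^ i * (-1) ^ i * (-(a₁ * q)) ^ i = (-1) ^ i * (a₁ * a₂) ^ i * q ^ i := by
    rw [neg_pow a₂, neg_pow (a₁ * q), mul_pow, mul_pow]
    linear_combination (-1) ^ i * a₁ ^ i * a₂ ^ i * q ^ i * hs
  have hA : (-a₂) ^ i * (-1) ^ i * (-(a₁ * q)) ^ i * ((a₁ * a₂) ^ i)⁻¹ * q ^ i.choose 2 *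
      qPoch q (q ^ (-(i : ℤ))) i = qPoch q q i := by
    rw [hp, ← hX, pow_add]
    field_simp
  rw [invWeight, edgeConst, edgeFactor, show i * (i + 1) / 2 = (i + 1).choose 2 by
      rw [Nat.choose_two_right, Nat.add_sub_cancel, mul_comm],
    Nat.choose_succ_succ' i 1, Nat.choose_one_right, one_add_one_eq_two, Nat.sub_self, zpow_neg, zpow_natCast, zpow_neg,
    zpow_natCast]
  simp only [qPoch_zero, pow_zero, Nat.choose_zero_succ, add_zero, one_mul, mul_one, div_one]
  have hq' := pow_ne_zero (i + i.choose 2) hq.ne'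
  calc _ = (q ^ ((3 * (i : ℝ) ^ 2 + (i : ℝ) + (n : ℝ) ^ 2) / 2 - (n : ℝ) * (i : ℝ)) *
      q ^ (-(((n - i : ℕ) : ℝ) ^ 2) / 2) * q ^ (-((i : ℝ) ^ 2) / 2)) * (q ^ (i + i.choose 2))⁻¹ *
      ((-a₂) ^ i * (-1) ^ i * (-(a₁ * q)) ^ i * ((a₁ * a₂) ^ i)⁻¹ * q ^ i.choose 2 *
        qPoch q (q ^ (-(i : ℤ))) i) * (qPoch q q i)⁻¹ *
      (qPoch q (a₁ * q) i * (qPoch q (a₁ * q) i)⁻¹) *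
      (qPoch q (a₂ * q) i * (qPoch q (a₂ * q) i)⁻¹) *
      (qPoch q (a₁ * a₂ * q ^ (i + 1)) i * (qPoch q (a₁ * a₂ * q ^ (i + 1)) i)⁻¹) *
      (qPoch q q (n - i) * (qPoch q q (n - i))⁻¹) *
      (qPoch q q i * (qPoch q q i)⁻¹) := by
        simp only [div_eq_mul_inv, mul_inv]
        ring
    _ = 1 := by
        rw [er, hA, mul_inv_cancel₀ hq', mul_inv_cancel₀ g1, mul_inv_cancel₀ g2,
          mul_inv_cancel₀ g3, mul_inv_cancel₀ (h i), mul_inv_cancel₀ (h (n - i))]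
        simp [h i]

theorem stmt18 (q : ℝ) (hq0 : 0 < q) (hq1 : q < 1)
    (α₁ α₂ α₃ : ℝ) (h₁ : 0 < α₁) (h₂ : 0 < α₂) (h₃ : 0 < α₃)
    (h₁' : α₁ < q⁻¹) (h₂' : α₂ < q⁻¹) (h₃' : α₃ < q⁻¹)
    (n : ℕ) (f : ℕ → ℕ → ℂ) (a : ℕ → ℂ)
    (hker : ∀ x₁ x₂ : ℕ, x₁ + x₂ + 1 ≤ n → L3 q α₁ α₂ α₃ n f x₁ x₂ = 0)
    (hrep : ∀ x₁ x₂ : ℕ, x₁ + x₂ ≤ n →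
      f x₁ x₂ = ∑ i ∈ Finset.range (n + 1), a i *
        (if i ≤ x₁ + x₂ then
          qHahnQ q (α₁ * α₂ * q ^ (2 * i + 1)) α₃ (n - i) (n - i) (x₁ + x₂ - i) *
            qHahnQ q α₁ α₂ i (x₁ + x₂) x₁
        else 0)) :
    ∀ i ≤ n, a i =
      (((-α₂) ^ i * qPoch q (α₁ * q) i *
          q ^ ((3 * (i : ℝ) ^ 2 + (i : ℝ) + (n : ℝ) ^ 2) / 2 - (n : ℝ) * (i : ℝ)) /
          (qPoch q q (n - i) * qPoch q (α₁ * α₂ * q ^ (i + 1)) i * qPoch q (α₂ * q) i *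
            qPoch q q i) : ℝ) : ℂ) *
        ∑ k ∈ Finset.range (i + 1),
          (((-1 : ℝ) ^ k * (α₁ * α₂) ^ (-(k : ℤ)) * q ^ (-((k * (k + 1) / 2 : ℕ) : ℤ)) *
              (qPoch q (α₃ * q ^ (n - i + 1)) (i - k) * qPoch q (q ^ (-(i : ℤ))) k *
                qPoch q (α₁ * α₂ * q ^ (i + 1)) k / qPoch q q k) : ℝ) : ℂ) *
          f k 0 := by
  intro i hi
  have hb1 : α₁ * q < 1 := by rwa [lt_inv_comm₀ h₁ hq0, ← one_div, lt_div_iff₀' h₁] at h₁'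
  have hb2 : α₂ * q < 1 := by rwa [lt_inv_comm₀ h₂ hq0, ← one_div, lt_div_iff₀' h₂] at h₂'
  have h : ∀ l, qPoch q q l ≠ 0 := fun l => (qPoch_pos hq0 hq1 hq0.le hq1 l).ne'
  have ht : α₁ * α₂ * q ^ 2 < 1 := by
    calc α₁ * α₂ * q ^ 2 = (α₁ * q) * (α₂ * q) := by ring
      _ < 1 := mul_lt_one_of_nonneg_of_lt_one_left (by positivity) hb1 hb2.le
  have ht' : ∀ j l, qPoch q (α₁ * α₂ * q ^ (j + 2)) l ≠ 0 := fun j l => by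
    refine (qPoch_pos hq0 hq1 (by positivity) (lt_of_le_of_lt ?_ ht) l).ne'
    gcongr ?_ * ?_
    exact pow_le_pow_of_le_one hq0.le hq1.le (by omega)
  have g1 : qPoch q (α₁ * q) i ≠ 0 := (qPoch_pos hq0 hq1 (by positivity) hb1 i).ne'
  have g2 : qPoch q (α₂ * q) i ≠ 0 := (qPoch_pos hq0 hq1 (by positivity) hb2 i).ne'
  have g3 : qPoch q (α₁ * α₂ * q ^ (i + 1)) i ≠ 0 := by
    rcases i with _ | i
    · simp [qPoch_zero]
    · exact ht' i _
  have hf : ∀ k ∈ Finset.range (i + 1), f k 0 = ∑ j ∈ Finset.range (n + 1), a j *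
      if j ≤ k then ((edgeConst q α₁ α₂ n j * edgeFactor q (α₁ * α₂) α₃ (n - k) j (k - j) : ℝ) : ℂ)
      else 0 := by
    intro k hk
    have hk' : k ≤ n := (Nat.lt_succ_iff.1 (Finset.mem_range.1 hk)).trans hi
    rw [hrep k 0 (by omega)]
    refine Finset.sum_congr rfl fun j _ => ?_
    congr 1
    rw [add_zero]
    split_ifs with hjk
    · obtain ⟨l, rfl⟩ := Nat.exists_eq_add_of_le hjk
      obtain ⟨r, rfl⟩ := Nat.exists_eq_add_of_le hk'
      rw [Nat.add_sub_cancel_left, Nat.add_sub_cancel_left,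
        ← edge_value q hq0.ne' α₁ α₂ α₃ h₂.ne' h₃.ne' h, show j + l + r - j = l + r by omega]
    · rfl
  have hinner : ∀ j ∈ Finset.range (n + 1), j ≠ i →
      ∑ k ∈ Finset.range (i + 1), (invWeight q (α₁ * α₂) α₃ (n - i) i k : ℂ) *
        (if j ≤ k then
          ((edgeConst q α₁ α₂ n j * edgeFactor q (α₁ * α₂) α₃ (n - k) j (k - j) : ℝ) : ℂ)
        else 0) = 0 := by
    intro j _ hji
    rcases lt_or_gt_of_ne hji with hlt | hgt
    · obtain ⟨m, rfl⟩ := Nat.exists_eq_add_of_le hlt.le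
      obtain ⟨s, rfl⟩ := Nat.exists_eq_add_of_le hi
      have hm : m ≠ 0 := by omega
      rw [add_assoc j m 1, Finset.sum_range_add, Finset.sum_eq_zero, zero_add]
      · have hz := sum_qPoch_eq_zero q (α₁ * α₂ * q ^ (j + (j + m) + 1))
          (α₁ * α₂ * q ^ (2 * j + 2)) hq0.ne' m hm (by ring) h (ht' _)
        have hterm : ∀ l ∈ Finset.range (m + 1),
            invWeight q (α₁ * α₂) α₃ s (j + m) (j + l) *
              (edgeConst q α₁ α₂ (j + m + s) j *
                edgeFactor q (α₁ * α₂) α₃ (j + m + s - (j + l)) j l) =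
            edgeConst q α₁ α₂ (j + m + s) j *
            ((-1 : ℝ) ^ j * ((α₁ * α₂) ^ j)⁻¹ * (q ^ (j + 1).choose 2)⁻¹ *
              qPoch q (q ^ (-((j + m : ℕ) : ℤ))) j * qPoch q (α₁ * α₂ * q ^ (j + m + 1)) j *
              qPoch q (α₃ * q ^ (s + 1)) m) *
            (q ^ l * (qPoch q (q ^ (-(m : ℤ))) l * qPoch q (α₁ * α₂ * q ^ (j + (j + m) + 1)) l) /
              (qPoch q q l * qPoch q (α₁ * α₂ * q ^ (2 * j + 2)) l)) := by
          intro l hl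
          obtain ⟨p, rfl⟩ := Nat.exists_eq_add_of_le (Nat.lt_succ_iff.1 (Finset.mem_range.1 hl))
          have hw := invWeight_mul_edgeFactor q hq0.ne' (α₁ * α₂) α₃ (mul_pos h₁ h₂).ne' h s j l p
          rw [show j + (l + p) + s - (j + l) = s + p by omega, mul_left_comm, hw]
          exact (mul_assoc _ _ _).symm
        have hsum := Finset.sum_congr rfl hterm
        rw [← Finset.mul_sum, hz, mul_zero] at hsum
        rw [← Complex.ofReal_zero, ← hsum, Complex.ofReal_sum]
        refine Finset.sum_congr rfl fun l _ => ?_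
        rw [if_pos (Nat.le_add_right j l), Nat.add_sub_cancel_left, Nat.add_sub_cancel_left,
          ← Complex.ofReal_mul]
      · intro k hk
        rw [if_neg (not_le.2 (Finset.mem_range.1 hk)), mul_zero]
    · refine Finset.sum_eq_zero fun k hk => ?_
      have := Finset.mem_range.1 hk
      rw [if_neg (by omega), mul_zero]
  have hself : ∑ k ∈ Finset.range (i + 1), (invWeight q (α₁ * α₂) α₃ (n - i) i k : ℂ) *
        (if i ≤ k then
          ((edgeConst q α₁ α₂ n i * edgeFactor q (α₁ * α₂) α₃ (n - k) i (k - i) : ℝ) : ℂ)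
        else 0) = ((invWeight q (α₁ * α₂) α₃ (n - i) i i *
          (edgeConst q α₁ α₂ n i * edgeFactor q (α₁ * α₂) α₃ (n - i) i 0) : ℝ) : ℂ) := by
    rw [Finset.sum_range_succ, Finset.sum_eq_zero, zero_add, if_pos le_rfl, Nat.sub_self,
      ← Complex.ofReal_mul]
    intro k hk
    rw [if_neg (not_le.2 (Finset.mem_range.1 hk)), mul_zero]
  have hsum : ∑ k ∈ Finset.range (i + 1), (invWeight q (α₁ * α₂) α₃ (n - i) i k : ℂ) * f k 0 =
      a i * ((invWeight q (α₁ * α₂) α₃ (n - i) i i *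
          (edgeConst q α₁ α₂ n i * edgeFactor q (α₁ * α₂) α₃ (n - i) i 0) : ℝ) : ℂ) := by
    rw [← hself, Finset.sum_congr rfl fun k hk => by rw [hf k hk, Finset.mul_sum],
      Finset.sum_comm, Finset.sum_eq_single_of_mem i (Finset.mem_range.2 (by omega))]
    · rw [Finset.mul_sum]
      exact Finset.sum_congr rfl fun k _ => mul_left_comm _ _ _
    · intro j hj hji
      simp only [mul_left_comm _ (a j)]
      rw [← Finset.mul_sum, hinner j hj hji, mul_zero]
  have hone := invWeight_mul_edge_self q hq0 α₁ α₂ α₃ h₁.ne' h₂.ne' h n i hi g1 g2 g3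
  simp only [invWeight] at hsum hone
  rw [hsum, mul_left_comm, ← Complex.ofReal_mul, hone, Complex.ofReal_one, mul_one]
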